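/- Let Λ ⊆ ℤ^d be finite, let F ⊆ Λ be nonempty and let α ∈ Λ ∖ F. For β ∈ F set q_β := ℙ_α(H_F < H_{ℤ^d∖Λ} and S_{H_F} = β), and define h_α := Σ_{β∈F} q_β ψ_β, where (ψ_γ)_{γ∈ℤ^d} is the DGFF with zero boundary conditions outside Λ. Then Var(h_α) = Σ_{β∈F} q_β·g_Λ(α,β), and consequently Var(h_α) ≤ sup_{β∈F} g_Λ(α,β) ≤ sup_{β∈F} g(α,β). -/

import Mathlib

open MeasureTheory ProbabilityTheory Real Filter Set

/-- `ℤ^d` as functions `Fin d → ℤ`. -/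
abbrev Zd (d : ℕ) := Fin d → ℤ

/-- One step of the simple random walk: move from `a` by `±1` in coordinate `i`. -/
def rwStep (d : ℕ) (i : Fin d) (s : Bool) (a : Zd d) : Zd d :=
  Function.update a i (a i + if s then 1 else -1)

/-- `m`-step transition probability of the simple random walk on `ℤ^d`. -/
noncomputable def rwP (d : ℕ) : ℕ → Zd d → Zd d → ℝ
  | 0, a, b => if a = b then 1 else 0
  | (m+1), a, b => (1 / (2 * d)) * ∑ i : Fin d, ∑ s : Bool, rwP d m (rwStep d i s a) b

/-- The Green's function `g(a,b)` of the simple random walk on `ℤ^d`. -/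
noncomputable def green (d : ℕ) (a b : Zd d) : ℝ := ∑' m, rwP d m a b

open Classical in
/-- Probability that the walk started at `a` is at `b` at time `m`, having stayed in `Λ`
at all times `0,…,m`. -/
noncomputable def rwPIn (d : ℕ) (Λ : Set (Zd d)) : ℕ → Zd d → Zd d → ℝ
  | 0, a, b => if a = b ∧ a ∈ Λ then 1 else 0
  | (m+1), a, b =>
      if a ∈ Λ then (1 / (2 * d)) * ∑ i : Fin d, ∑ s : Bool, rwPIn d Λ m (rwStep d i s a) b
      else 0

/-- Dirichlet Green's function `g_Λ(a,b)` (killed upon exiting `Λ`). -/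
noncomputable def greenIn (d : ℕ) (Λ : Set (Zd d)) (a b : Zd d) : ℝ := ∑' m, rwPIn d Λ m a b

open Classical in
/-- Probability that the walk started at `a` first hits `F` at time `m`, at the point `b`. -/
noncomputable def hitP (d : ℕ) (F : Set (Zd d)) : ℕ → Zd d → Zd d → ℝ
  | 0, a, b => if a = b ∧ b ∈ F then 1 else 0
  | (m+1), a, b =>
      if a ∈ F then 0
      else (1 / (2 * d)) * ∑ i : Fin d, ∑ s : Bool, hitP d F m (rwStep d i s a) b

open Classical in
/-- Probability that the walk started at `a` first hits `F` at time `m`, at the point `b`,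
before exiting `Λ`. -/
noncomputable def hitPIn (d : ℕ) (Λ F : Set (Zd d)) : ℕ → Zd d → Zd d → ℝ
  | 0, a, b => if a = b ∧ b ∈ F ∧ b ∈ Λ then 1 else 0
  | (m+1), a, b =>
      if a ∈ Λ ∧ a ∉ F then
        (1 / (2 * d)) * ∑ i : Fin d, ∑ s : Bool, hitPIn d Λ F m (rwStep d i s a) b
      else 0

/-- `ℙ_a(H_F < ∞, S_{H_F} = b)`, the harmonic measure of `F` seen from `a`. -/
noncomputable def hitMeas (d : ℕ) (F : Set (Zd d)) (a b : Zd d) : ℝ := ∑' m, hitP d F m a b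

/-- `ℙ_a(H_F < H_{ℤ^d∖Λ}, S_{H_F} = b)`. -/
noncomputable def hitMeasIn (d : ℕ) (Λ F : Set (Zd d)) (a b : Zd d) : ℝ :=
  ∑' m, hitPIn d Λ F m a b

/-- `(φ_a)_{a∈ℤ^d}` is a centered Gaussian field with covariance `G`: every finite linear
combination is a centered Gaussian with the prescribed variance. -/
def IsGaussianField {Ω : Type*} [MeasurableSpace Ω] (P : Measure Ω) (d : ℕ)
    (G : Zd d → Zd d → ℝ) (φ : Zd d → Ω → ℝ) : Prop :=
  (∀ a, Measurable (φ a)) ∧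
    ∀ c : Zd d →₀ ℝ,
      Measure.map (fun ω => ∑ a ∈ c.support, c a * φ a ω) P =
        gaussianReal 0
          (Real.toNNReal (∑ a ∈ c.support, ∑ b ∈ c.support, c a * c b * G a b))

/-- The centering sequence `b_N` (here `g0 = g(0)` is the variance of the field). -/
noncomputable def bN (g0 : ℝ) (N : ℕ) : ℝ :=
  Real.sqrt g0 * (Real.sqrt (2 * Real.log N) -
    (Real.log (Real.log N) + Real.log (4 * π)) / (2 * Real.sqrt (2 * Real.log N)))

/-- The scaling sequence `a_N = g(0)/b_N`. -/
noncomputable def aN (g0 : ℝ) (N : ℕ) : ℝ := g0 / bN g0 N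

/-- `u_N(z) = a_N z + b_N`. -/
noncomputable def uN (g0 : ℝ) (N : ℕ) (z : ℝ) : ℝ := aN g0 N * z + bN g0 N

/-- The box `V_N = ([0,n-1]^d) ∩ ℤ^d`, `N = n^d`. -/
noncomputable def VN (d n : ℕ) : Finset (Zd d) :=
  Fintype.piFinset fun _ => Finset.Icc (0 : ℤ) ((n : ℤ) - 1)

/-- The `ℓ∞` distance between two points of `ℤ^d`, as a real number. -/
noncomputable def distInf (d : ℕ) (a b : Zd d) : ℝ :=
  ((Finset.univ.sup fun i => (a i - b i).natAbs : ℕ) : ℝ)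

open Classical in
/-- The bulk `V_N^δ` of the box `V_N`. -/
noncomputable def bulk (d n : ℕ) (δ : ℝ) : Finset (Zd d) :=
  (VN d n).filter fun a => ∀ b : Zd d, b ∉ VN d n → δ * n < distInf d a b

/-- The rectangle `∏_i ([0,1] ∩ (lo i, hi i])` in `[0,1]^d`. -/
def rect (d : ℕ) (lo hi : Fin d → ℝ) : Set (Fin d → ℝ) :=
  {t | ∀ i, t i ∈ Set.Icc (0 : ℝ) 1 ∩ Set.Ioc (lo i) (hi i)}

open Classical in
/-- `nA ∩ V_N = {α ∈ V_N : α/n ∈ A}` for the rectangle `A = rect d lo hi`. -/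
noncomputable def rectIdx (d n : ℕ) (lo hi : Fin d → ℝ) : Finset (Zd d) :=
  (VN d n).filter fun a => (fun i => (a i : ℝ) / n) ∈ rect d lo hi

/-- `e^{-y}` for `y ∈ (-∞,+∞]`, with the convention `e^{-∞} = 0`. -/
noncomputable def expE (y : EReal) : ℝ := if y = ⊤ then 0 else Real.exp (-y.toReal)

/-- `u_N` extended to `(-∞,+∞]` by `u_N(+∞) = +∞`. -/
noncomputable def uNE (g0 : ℝ) (N : ℕ) (y : EReal) : EReal :=
  if y = ⊤ then ⊤ else ((uN g0 N y.toReal : ℝ) : EReal)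

/-- `ω(R) = ∫_R e^{-z} dz` for `R ⊆ (-∞,+∞]`. -/
noncomputable def omegaMeas (R : Set EReal) : ℝ :=
  ∫ t in {t : ℝ | (t : EReal) ∈ R}, Real.exp (-t)

/-- `R ⊆ (-∞,+∞]` is a finite union of disjoint intervals `(x,y]` with
`-∞ < x < y ≤ +∞`. -/
def IsFiniteUnionIoc (R : Set EReal) : Prop :=
  ∃ (m : ℕ) (w : Fin m → ℝ) (r : Fin m → EReal),
    (∀ l, (w l : EReal) < r l) ∧
    (Pairwise fun l l' =>
      Disjoint (Set.Ioc (w l : EReal) (r l)) (Set.Ioc (w l' : EReal) (r l'))) ∧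
    R = ⋃ l, Set.Ioc ((w l : ℝ) : EReal) (r l)

/-- The average of `h` over the `2d` nearest neighbours of `a`. -/
noncomputable def nbrAvg (d : ℕ) (h : Zd d → ℝ) (a : Zd d) : ℝ :=
  (1 / (2 * d)) * ∑ i : Fin d, ∑ s : Bool, h (rwStep d i s a)

lemma nbrAvg_mono {d : ℕ} {h k : Zd d → ℝ} (hk : ∀ x, h x ≤ k x) (a : Zd d) :
    nbrAvg d h a ≤ nbrAvg d k a := by
  unfold nbrAvg
  gcongr
  exact hk _

lemma nbrAvg_const {d : ℕ} (hd : 0 < d) (r : ℝ) (a : Zd d) : nbrAvg d (fun _ => r) a = r := by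
  have : (d : ℝ) ≠ 0 := by positivity
  simp only [nbrAvg, Finset.sum_const, Finset.card_univ, Fintype.card_fin, Fintype.card_bool,
    nsmul_eq_mul]
  push_cast
  field_simp

lemma nbrAvg_nonneg {d : ℕ} {h : Zd d → ℝ} (hh : ∀ x, 0 ≤ h x) (a : Zd d) :
    0 ≤ nbrAvg d h a := by
  unfold nbrAvg
  exact mul_nonneg (by positivity) (Finset.sum_nonneg fun i _ => Finset.sum_nonneg fun s _ => hh _)

lemma nbrAvg_sum {d : ℕ} {ι : Type*} (S : Finset ι) (h : ι → Zd d → ℝ) (a : Zd d) :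
    nbrAvg d (fun x => ∑ j ∈ S, h j x) a = ∑ j ∈ S, nbrAvg d (h j) a := by
  simp only [nbrAvg, ← Finset.mul_sum]
  congr 1
  rw [Finset.sum_comm (s := S)]
  refine Finset.sum_congr rfl fun i _ => ?_
  rw [Finset.sum_comm (s := S)]

lemma nbrAvg_mul_const {d : ℕ} (h : Zd d → ℝ) (r : ℝ) (a : Zd d) :
    nbrAvg d (fun x => h x * r) a = nbrAvg d h a * r := by
  simp only [nbrAvg, ← Finset.sum_mul, mul_assoc]

lemma rwP_succ (d m : ℕ) (a b : Zd d) :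
    rwP d (m + 1) a b = nbrAvg d (fun x => rwP d m x b) a := rfl

open Classical in
lemma rwPIn_succ (d : ℕ) (Λ : Set (Zd d)) (m : ℕ) (a b : Zd d) :
    rwPIn d Λ (m + 1) a b = if a ∈ Λ then nbrAvg d (fun x => rwPIn d Λ m x b) a else 0 := rfl

open Classical in
lemma hitPIn_succ (d : ℕ) (Λ F : Set (Zd d)) (m : ℕ) (a b : Zd d) :
    hitPIn d Λ F (m + 1) a b =
      if a ∈ Λ ∧ a ∉ F then nbrAvg d (fun x => hitPIn d Λ F m x b) a else 0 := rfl

lemma rwP_nonneg (d m : ℕ) (a b : Zd d) : 0 ≤ rwP d m a b := by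
  induction m generalizing a with
  | zero => unfold rwP; split_ifs <;> norm_num
  | succ m ih => exact nbrAvg_nonneg (fun x => ih x) a

lemma rwPIn_nonneg (d : ℕ) (Λ : Set (Zd d)) (m : ℕ) (a b : Zd d) : 0 ≤ rwPIn d Λ m a b := by
  induction m generalizing a with
  | zero => unfold rwPIn; split_ifs <;> norm_num
  | succ m ih =>
    rw [rwPIn_succ]
    split_ifs
    exacts [nbrAvg_nonneg (fun x => ih x) a, le_rfl]

lemma hitPIn_nonneg (d : ℕ) (Λ F : Set (Zd d)) (m : ℕ) (a b : Zd d) :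
    0 ≤ hitPIn d Λ F m a b := by
  induction m generalizing a with
  | zero => unfold hitPIn; split_ifs <;> norm_num
  | succ m ih =>
    rw [hitPIn_succ]
    split_ifs
    exacts [nbrAvg_nonneg (fun x => ih x) a, le_rfl]

lemma rwPIn_le_rwP (d : ℕ) (Λ : Set (Zd d)) (m : ℕ) (a b : Zd d) :
    rwPIn d Λ m a b ≤ rwP d m a b := by
  induction m generalizing a with
  | zero =>
    unfold rwPIn rwP
    by_cases h : a = b <;> by_cases h' : a ∈ Λ <;> simp [h, h'] <;> split_ifs <;> norm_num
  | succ m ih =>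
    rw [rwPIn_succ, rwP_succ]
    split_ifs
    exacts [nbrAvg_mono (fun x => ih x) a, nbrAvg_nonneg (fun x => rwP_nonneg d m x b) a]

/-- A nonnegative superharmonic function whose Laplacian is at most `-c` at `b` bounds the
truncated Green's function. -/
lemma sum_rwP_le_of_superharmonic {d : ℕ} {f : Zd d → ℝ} {b : Zd d} {c : ℝ} (hc : 0 < c)
    (hf : ∀ x, 0 ≤ f x) (hsup : ∀ x, nbrAvg d f x ≤ f x) (hb : nbrAvg d f b + c ≤ f b)
    (M : ℕ) (a : Zd d) : ∑ m ∈ Finset.range M, rwP d m a b ≤ f a * c⁻¹ := by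
  induction M generalizing a with
  | zero => simpa using mul_nonneg (hf a) (inv_nonneg.2 hc.le)
  | succ M ih =>
    rw [Finset.sum_range_succ']
    have h1 : ∑ m ∈ Finset.range M, rwP d (m + 1) a b ≤ nbrAvg d f a * c⁻¹ := by
      simp only [rwP_succ]
      rw [← nbrAvg_sum, ← nbrAvg_mul_const]
      exact nbrAvg_mono ih a
    have hc' : 0 < c⁻¹ := inv_pos.2 hc
    by_cases hab : a = b
    · subst hab
      have h2 : (nbrAvg d f a + c) * c⁻¹ ≤ f a * c⁻¹ := by gcongr
      rw [add_mul, mul_inv_cancel₀ hc.ne'] at h2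
      have h0 : rwP d 0 a a = 1 := if_pos rfl
      linarith
    · have h2 : nbrAvg d f a * c⁻¹ ≤ f a * c⁻¹ := by gcongr; exact hsup a
      have h0 : rwP d 0 a b = 0 := if_neg hab
      linarith

lemma one_add_rpow_neg_quarter_le {t : ℝ} (h₁ : -(1 / 10) ≤ t) (h₂ : t ≤ 1 / 10) :
    (1 + t) ^ (-(1 / 4) : ℝ) ≤ 1 - t / 4 + 3 / 16 * t ^ 2 := by
  have ht : 0 < 1 + t := by linarith
  have hp : 0 ≤ 1 - t / 4 + 3 / 16 * t ^ 2 := by nlinarith [sq_nonneg t]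
  refine le_of_pow_le_pow_left₀ (n := 4) (by norm_num) hp ?_
  have h4 : ((1 + t) ^ (-(1 / 4) : ℝ)) ^ 4 = (1 + t)⁻¹ := by
    rw [← rpow_natCast, ← rpow_mul ht.le, ← rpow_neg_one]
    norm_num
  rw [h4, inv_le_iff_one_le_mul₀ ht]
  have hs0 : 0 ≤ t ^ 2 := sq_nonneg t
  have hs1 : t ^ 2 ≤ 1 / 100 := by nlinarith
  have hL : 0 ≤ 1 - t / 2 + 7 / 16 * t ^ 2 - 3 / 32 * t ^ 3 := by
    nlinarith [mul_nonneg hs0 (sub_nonneg.2 h₂)]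
  have hLp : 1 - t / 2 + 7 / 16 * t ^ 2 - 3 / 32 * t ^ 3 ≤
      (1 - t / 4 + 3 / 16 * t ^ 2) ^ 2 := by nlinarith [sq_nonneg (t ^ 2)]
  have hrem : 0 ≤ 1 / 8 + t / 2 - 87 / 256 * t ^ 2 + 52 / 256 * t ^ 3 - 75 / 1024 * t ^ 4
      + 9 / 1024 * t ^ 5 := by
    have h3 : 0 ≤ t ^ 2 * (t + 1 / 10) := mul_nonneg hs0 (by linarith)
    have h4 : 0 ≤ t ^ 2 * (1 / 100 - t ^ 2) := mul_nonneg hs0 (by linarith)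
    have h5 : 0 ≤ (t ^ 2) ^ 2 * (t + 1 / 10) := mul_nonneg (sq_nonneg _) (by linarith)
    nlinarith
  calc 1 ≤ 1 + t ^ 2 * (1 / 8 + t / 2 - 87 / 256 * t ^ 2 + 52 / 256 * t ^ 3 - 75 / 1024 * t ^ 4
          + 9 / 1024 * t ^ 5) := le_add_of_nonneg_right (mul_nonneg hs0 hrem)
    _ = (1 - t / 2 + 7 / 16 * t ^ 2 - 3 / 32 * t ^ 3) ^ 2 * (1 + t) := by ring
    _ ≤ ((1 - t / 4 + 3 / 16 * t ^ 2) ^ 2) ^ 2 * (1 + t) := by gcongr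
    _ = (1 - t / 4 + 3 / 16 * t ^ 2) ^ 4 * (1 + t) := by ring

lemma one_add_quarter_le_rpow {v : ℝ} (h₀ : 0 ≤ v) (h₁ : v < 1) :
    1 + v / 4 ≤ (1 - v) ^ (-(1 / 4) : ℝ) := by
  have h := rpow_one_add_le_one_add_mul_self (s := -v) (p := 1 / 4) (by linarith)
    (by norm_num) (by norm_num)
  have hpos : 0 < (1 - v) ^ (1 / 4 : ℝ) := rpow_pos_of_pos (by linarith) _
  rw [← sub_eq_add_neg] at h
  rw [rpow_neg (by linarith), ← one_div, le_div_iff₀ hpos]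
  nlinarith

/-- The squared Euclidean norm on `ℤ^d`. -/
noncomputable def sqNorm (d : ℕ) (x : Zd d) : ℝ := ∑ i, (x i : ℝ) ^ 2

lemma sqNorm_nonneg (d : ℕ) (x : Zd d) : 0 ≤ sqNorm d x := Finset.sum_nonneg fun _ _ => sq_nonneg _

lemma sqNorm_rwStep_sub (d : ℕ) (i : Fin d) (s : Bool) (a b : Zd d) :
    sqNorm d (rwStep d i s a - b) =
      sqNorm d (a - b) + 1 + 2 * (if s then 1 else -1) * ((a - b) i : ℤ) := by
  unfold sqNorm
  rw [← Finset.add_sum_erase _ _ (Finset.mem_univ i),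
    ← Finset.add_sum_erase (a := i) _ (fun j => (((a - b) j : ℤ) : ℝ) ^ 2) (Finset.mem_univ i)]
  have : ∀ j ∈ Finset.univ.erase i, (((rwStep d i s a - b) j : ℤ) : ℝ) ^ 2 =
      (((a - b) j : ℤ) : ℝ) ^ 2 := by
    intro j hj
    simp [rwStep, Function.update_of_ne (Finset.ne_of_mem_erase hj)]
  rw [Finset.sum_congr rfl this]
  cases s <;> simp [rwStep] <;> ring

/-- A strictly superharmonic function on `ℤ^d`, `d ≥ 3`. -/
noncomputable def lyap (d : ℕ) (b x : Zd d) : ℝ := (sqNorm d (x - b) + 99) ^ (-(1 / 4) : ℝ)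

lemma nbrAvg_lyap_lt {d : ℕ} (hd : 3 ≤ d) (b a : Zd d) :
    nbrAvg d (lyap d b) a < lyap d b a := by
  set r := sqNorm d (a - b) with hr
  have hr0 : 0 ≤ r := sqNorm_nonneg _ _
  set u := r + 100 with hu
  have hu0 : 0 < u := by positivity
  have hd0 : (0 : ℝ) < d := by positivity
  have hd3 : (3 : ℝ) ≤ d := by exact_mod_cast hd
  have hle : ∀ i : Fin d, (((a - b) i : ℤ) : ℝ) ^ 2 ≤ r := fun i =>
    Finset.single_le_sum (f := fun i => (((a - b) i : ℤ) : ℝ) ^ 2) (fun _ _ => sq_nonneg _)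
      (Finset.mem_univ i)
  have hpair : ∀ i : Fin d, ∑ s : Bool, lyap d b (rwStep d i s a) ≤
      u ^ (-(1 / 4) : ℝ) * (2 + 3 / 2 * (((a - b) i : ℤ) : ℝ) ^ 2 / u ^ 2) := by
    intro i
    set y : ℝ := (((a - b) i : ℤ) : ℝ) with hy
    have hy2 : y ^ 2 ≤ r := hle i
    have hyu : |2 * y / u| ≤ 1 / 10 := by
      rw [abs_div, abs_of_pos hu0, div_le_iff₀ hu0]
      refine abs_le.2 ⟨?_, ?_⟩ <;> nlinarith [sq_nonneg (y - 10), sq_nonneg (y + 10)]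
    obtain ⟨hl, hh⟩ := abs_le.1 hyu
    have e1 : lyap d b (rwStep d i true a) =
        u ^ (-(1 / 4) : ℝ) * (1 + 2 * y / u) ^ (-(1 / 4) : ℝ) := by
      rw [← mul_rpow hu0.le (by linarith), lyap, sqNorm_rwStep_sub, ← hr, ← hy]
      congr 1
      field_simp
      simp [hu]; ring
    have e2 : lyap d b (rwStep d i false a) =
        u ^ (-(1 / 4) : ℝ) * (1 + -(2 * y / u)) ^ (-(1 / 4) : ℝ) := by
      rw [← mul_rpow hu0.le (by linarith), lyap, sqNorm_rwStep_sub, ← hr, ← hy]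
      congr 1
      field_simp
      simp [hu]; ring
    rw [Fintype.sum_bool, e1, e2, ← mul_add]
    have b1 := one_add_rpow_neg_quarter_le hl hh
    have b2 := one_add_rpow_neg_quarter_le (t := -(2 * y / u)) (by linarith) (by linarith)
    refine mul_le_mul_of_nonneg_left ?_ (rpow_nonneg hu0.le _)
    have : 3 / 2 * y ^ 2 / u ^ 2 = 3 / 8 * (2 * y / u) ^ 2 := by field_simp; ring
    rw [this]
    linarith
  have hself : u ^ (-(1 / 4) : ℝ) * (1 + 1 / u / 4) ≤ lyap d b a := by
    have hv : 1 / u < 1 := by rw [div_lt_one hu0]; linarith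
    have e : lyap d b a = u ^ (-(1 / 4) : ℝ) * (1 - 1 / u) ^ (-(1 / 4) : ℝ) := by
      rw [← mul_rpow hu0.le (by linarith), lyap, ← hr]
      congr 1
      field_simp
      simp [hu]; ring
    rw [e]
    have := one_add_quarter_le_rpow (v := 1 / u) (by positivity) hv
    gcongr
  have hmean : nbrAvg d (lyap d b) a ≤
      u ^ (-(1 / 4) : ℝ) * (1 + 1 / (2 * d) * (3 / 2 * r / u ^ 2)) := by
    unfold nbrAvg
    calc _ ≤ 1 / (2 * (d : ℝ)) * ∑ i : Fin d,
          u ^ (-(1 / 4) : ℝ) * (2 + 3 / 2 * (((a - b) i : ℤ) : ℝ) ^ 2 / u ^ 2) := by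
          gcongr with i
          exact hpair i
      _ = _ := by
          rw [← Finset.mul_sum, Finset.sum_add_distrib, ← Finset.sum_div, ← Finset.mul_sum, hr,
            sqNorm]
          simp only [Finset.sum_const, Finset.card_univ, Fintype.card_fin, nsmul_eq_mul]
          field_simp
  refine hmean.trans_lt (lt_of_lt_of_le ?_ hself)
  refine mul_lt_mul_of_pos_left (add_lt_add_right ?_ 1) (rpow_pos_of_pos hu0 _)
  calc 1 / (2 * (d : ℝ)) * (3 / 2 * r / u ^ 2) ≤ 1 / (2 * 3) * (3 / 2 * r / u ^ 2) := by gcongr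
    _ < 1 / u / 4 := by
      field_simp
      linarith

/-- Transience of the simple random walk on `ℤ^d`, `d ≥ 3`. -/
lemma summable_rwP {d : ℕ} (hd : 3 ≤ d) (a b : Zd d) : Summable fun m => rwP d m a b := by
  refine summable_of_sum_range_le (c := lyap d b a * (lyap d b b - nbrAvg d (lyap d b) b)⁻¹)
    (fun m => rwP_nonneg d m a b) fun M => ?_
  refine sum_rwP_le_of_superharmonic (sub_pos.2 (nbrAvg_lyap_lt hd b b)) (fun x => ?_)
    (fun x => (nbrAvg_lyap_lt hd b x).le) (by linarith) M a
  have := sqNorm_nonneg d (x - b)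
  exact rpow_nonneg (by linarith) _

lemma summable_rwPIn {d : ℕ} (hd : 3 ≤ d) (Λ : Set (Zd d)) (a b : Zd d) :
    Summable fun m => rwPIn d Λ m a b :=
  (summable_rwP hd a b).of_nonneg_of_le (fun m => rwPIn_nonneg d Λ m a b)
    fun m => rwPIn_le_rwP d Λ m a b

lemma greenIn_le_green {d : ℕ} (hd : 3 ≤ d) (Λ : Set (Zd d)) (a b : Zd d) :
    greenIn d Λ a b ≤ green d a b :=
  (summable_rwPIn hd Λ a b).tsum_le_tsum (fun m => rwPIn_le_rwP d Λ m a b) (summable_rwP hd a b)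

lemma greenIn_nonneg (d : ℕ) (Λ : Set (Zd d)) (a b : Zd d) : 0 ≤ greenIn d Λ a b :=
  tsum_nonneg fun m => rwPIn_nonneg d Λ m a b

lemma hitMeasIn_nonneg (d : ℕ) (Λ F : Set (Zd d)) (a b : Zd d) : 0 ≤ hitMeasIn d Λ F a b :=
  tsum_nonneg fun m => hitPIn_nonneg d Λ F m a b

lemma sum_hitPIn_zero_le (d : ℕ) (Λ F : Set (Zd d)) (S : Finset (Zd d)) (a : Zd d) :
    ∑ b ∈ S, hitPIn d Λ F 0 a b ≤ 1 := by
  classical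
  calc ∑ b ∈ S, hitPIn d Λ F 0 a b ≤ ∑ b ∈ S, if a = b then (1 : ℝ) else 0 := by
        refine Finset.sum_le_sum fun b _ => ?_
        unfold hitPIn
        by_cases h : a = b <;> simp [h]
        split_ifs <;> norm_num
    _ ≤ 1 := by
        rw [Finset.sum_ite_eq]
        split_ifs <;> norm_num

lemma sum_range_sum_hitPIn_le {d : ℕ} (hd : 0 < d) (Λ F : Set (Zd d)) (S : Finset (Zd d))
    (M : ℕ) (a : Zd d) : ∑ m ∈ Finset.range M, ∑ b ∈ S, hitPIn d Λ F m a b ≤ 1 := by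
  induction M generalizing a with
  | zero => simp
  | succ M ih =>
    rw [Finset.sum_range_succ']
    simp only [hitPIn_succ]
    by_cases h : a ∈ Λ ∧ a ∉ F
    · have h0 : ∀ b, hitPIn d Λ F 0 a b = 0 := by
        intro b
        unfold hitPIn
        rw [if_neg]
        rintro ⟨rfl, hb, -⟩
        exact h.2 hb
      simp only [if_pos h, h0, Finset.sum_const_zero, add_zero]
      simp only [← nbrAvg_sum]
      exact (nbrAvg_mono ih a).trans_eq (nbrAvg_const hd 1 a)
    · simpa [if_neg h] using sum_hitPIn_zero_le d Λ F S a

lemma summable_hitPIn {d : ℕ} (hd : 0 < d) (Λ F : Set (Zd d)) (a b : Zd d) :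
    Summable fun m => hitPIn d Λ F m a b :=
  summable_of_sum_range_le (c := 1) (fun m => hitPIn_nonneg d Λ F m a b) fun M => by
    simpa using sum_range_sum_hitPIn_le hd Λ F {b} M a

lemma sum_hitMeasIn_le_one {d : ℕ} (hd : 0 < d) (Λ F : Set (Zd d)) (S : Finset (Zd d))
    (a : Zd d) : ∑ b ∈ S, hitMeasIn d Λ F a b ≤ 1 := by
  unfold hitMeasIn
  rw [← Summable.tsum_finsetSum fun b _ => summable_hitPIn hd Λ F a b]
  exact Real.tsum_le_of_sum_range_le
    (fun m => Finset.sum_nonneg fun b _ => hitPIn_nonneg d Λ F m a b)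
    fun M => sum_range_sum_hitPIn_le hd Λ F S M a

/-- The first-passage decomposition of the killed walk at the hitting time of `F`. -/
lemma rwPIn_eq_sum_hitPIn {d : ℕ} {Λ : Set (Zd d)} {F : Finset (Zd d)} (hFΛ : (F : Set (Zd d)) ⊆ Λ)
    {c : Zd d} (hc : c ∈ F) (m : ℕ) (a : Zd d) :
    rwPIn d Λ m a c =
      ∑ b ∈ F, ∑ k ∈ Finset.range (m + 1), hitPIn d Λ F k a b * rwPIn d Λ (m - k) b c := by
  classical
  by_cases haF : a ∈ F
  · have haΛ : a ∈ Λ := hFΛ haF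
    rw [Finset.sum_eq_single_of_mem a haF]
    · rw [Finset.sum_range_succ']
      simp [haF, hitPIn, haΛ]
    · intro b _ hb
      rw [Finset.sum_range_succ']
      simp [haF, hitPIn, hb.symm]
  have h0 : ∀ b ∈ F, hitPIn d Λ F 0 a b = 0 := by
    intro b hb
    unfold hitPIn
    rw [if_neg]
    rintro ⟨rfl, -, -⟩
    exact haF hb
  cases m with
  | zero =>
    have hac : a ≠ c := fun h => haF (h ▸ hc)
    rw [Finset.sum_eq_zero fun b hb => by simp [h0 b hb]]
    simp [rwPIn, hac]
  | succ m =>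
    have key : ∀ b ∈ F, ∑ k ∈ Finset.range (m + 1 + 1),
        hitPIn d Λ F k a b * rwPIn d Λ (m + 1 - k) b c =
        ∑ k ∈ Finset.range (m + 1), hitPIn d Λ F (k + 1) a b * rwPIn d Λ (m - k) b c := by
      intro b hb
      rw [Finset.sum_range_succ', h0 b hb, zero_mul, add_zero]
      simp only [Nat.add_sub_add_right]
    rw [Finset.sum_congr rfl key, rwPIn_succ]
    by_cases haΛ : a ∈ Λ
    · have hmem : a ∈ Λ ∧ a ∉ (F : Set (Zd d)) := ⟨haΛ, by simpa using haF⟩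
      simp only [hitPIn_succ, if_pos haΛ, if_pos hmem, ← nbrAvg_mul_const, ← nbrAvg_sum]
      exact congrArg (fun h => nbrAvg d h a)
        (funext fun x => rwPIn_eq_sum_hitPIn hFΛ hc m x)
    · simp [hitPIn_succ, haΛ]

/-- The strong Markov property at the hitting time of `F`. -/
lemma sum_hitMeasIn_mul_greenIn {d : ℕ} (hd : 3 ≤ d) {Λ : Set (Zd d)} {F : Finset (Zd d)}
    (hFΛ : (F : Set (Zd d)) ⊆ Λ) {c : Zd d} (hc : c ∈ F) (a : Zd d) :
    ∑ b ∈ F, hitMeasIn d Λ F a b * greenIn d Λ b c = greenIn d Λ a c := by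
  have hd0 : 0 < d := by omega
  have hn1 : ∀ b, Summable fun m => ‖hitPIn d Λ F m a b‖ :=
    fun b => (summable_hitPIn hd0 Λ F a b).norm
  have hn2 : ∀ b, Summable fun m => ‖rwPIn d Λ m b c‖ :=
    fun b => (summable_rwPIn hd Λ b c).norm
  calc _ = ∑ b ∈ F, ∑' m, ∑ k ∈ Finset.range (m + 1), hitPIn d Λ F k a b * rwPIn d Λ (m - k) b c :=
        Finset.sum_congr rfl fun b _ =>
          tsum_mul_tsum_eq_tsum_sum_range_of_summable_norm (hn1 b) (hn2 b)
    _ = ∑' m, ∑ b ∈ F, ∑ k ∈ Finset.range (m + 1), hitPIn d Λ F k a b * rwPIn d Λ (m - k) b c :=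
        (Summable.tsum_finsetSum fun b _ =>
          (summable_norm_sum_mul_range_of_summable_norm (hn1 b) (hn2 b)).of_norm).symm
    _ = _ := tsum_congr fun m => (rwPIn_eq_sum_hitPIn hFΛ hc m a).symm

lemma IsGaussianField.variance_sum {Ω : Type*} [MeasurableSpace Ω] {P : Measure Ω} {d : ℕ}
    {G : Zd d → Zd d → ℝ} {φ : Zd d → Ω → ℝ} (hφ : IsGaussianField P d G φ)
    (F : Finset (Zd d)) (q : Zd d → ℝ)
    (hq : 0 ≤ ∑ a ∈ F, ∑ b ∈ F, q a * q b * G a b) :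
    variance (fun ω => ∑ b ∈ F, q b * φ b ω) P = ∑ a ∈ F, ∑ b ∈ F, q a * q b * G a b := by
  classical
  set c : Zd d →₀ ℝ := Finsupp.indicator F fun b _ => q b with hcdef
  have hcF : c.support ⊆ F := Finsupp.support_indicator_subset F _
  have hcv : ∀ b ∈ F, c b = q b := fun b hb => Finsupp.indicator_of_mem hb _
  have hsum : ∀ h : Zd d → ℝ, ∑ b ∈ c.support, c b * h b = ∑ b ∈ F, q b * h b := by
    intro h
    rw [Finset.sum_subset hcF fun b _ hb => by simp [Finsupp.notMem_support_iff.1 hb]]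
    exact Finset.sum_congr rfl fun b hb => by rw [hcv b hb]
  have hquad : ∑ a ∈ c.support, ∑ b ∈ c.support, c a * c b * G a b =
      ∑ a ∈ F, ∑ b ∈ F, q a * q b * G a b := by
    simp only [mul_assoc, ← Finset.mul_sum, hsum]
  have hmap := hφ.2 c
  simp only [hsum, hquad] at hmap
  have hmeas : Measurable fun ω => ∑ b ∈ F, q b * φ b ω :=
    Finset.measurable_sum _ fun b _ => (hφ.1 b).const_mul _
  have := variance_id_map (μ := P) hmeas.aemeasurable
  rw [← this, hmap, variance_id_gaussianReal, Real.coe_toNNReal _ hq]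

/-- Variance of the harmonic average
`h_α = Σ_{β∈F} ℙ_α(H_F < H_{ℤ^d∖Λ}, S_{H_F}=β) ψ_β` of the zero-boundary DGFF on `Λ` equals
`Σ_{β∈F} ℙ_α(H_F < H_{ℤ^d∖Λ}, S_{H_F}=β) g_Λ(α,β)`, and is therefore bounded by
`sup_{β∈F} g_Λ(α,β) ≤ sup_{β∈F} g(α,β)`. -/
theorem variance_harmonic_average_finite_volume
    (d : ℕ) (hd : 3 ≤ d)
    {Ω : Type*} [MeasurableSpace Ω] (P : Measure Ω) [IsProbabilityMeasure P]
    (Λ : Finset (Zd d)) (F : Finset (Zd d)) (hF : F.Nonempty) (hFΛ : F ⊆ Λ)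
    (ψ : Zd d → Ω → ℝ) (hψ : IsGaussianField P d (greenIn d (Λ : Set (Zd d))) ψ)
    (hψ0 : ∀ c ∉ Λ, ∀ᵐ ω ∂P, ψ c ω = 0)
    (a : Zd d) (haΛ : a ∈ Λ) (ha : a ∉ F) :
    variance (fun ω =>
        ∑ b ∈ F, hitMeasIn d (Λ : Set (Zd d)) (F : Set (Zd d)) a b * ψ b ω) P
        = ∑ b ∈ F, hitMeasIn d (Λ : Set (Zd d)) (F : Set (Zd d)) a b
            * greenIn d (Λ : Set (Zd d)) a b ∧
      variance (fun ω =>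
        ∑ b ∈ F, hitMeasIn d (Λ : Set (Zd d)) (F : Set (Zd d)) a b * ψ b ω) P
        ≤ F.sup' hF (fun b => greenIn d (Λ : Set (Zd d)) a b) ∧
      F.sup' hF (fun b => greenIn d (Λ : Set (Zd d)) a b)
        ≤ F.sup' hF fun b => green d a b := by
  set q := hitMeasIn d (Λ : Set (Zd d)) (F : Set (Zd d)) a with hq
  have hFΛ' : (F : Set (Zd d)) ⊆ Λ := by exact_mod_cast hFΛ
  have hq0 : ∀ b, 0 ≤ q b := hitMeasIn_nonneg d _ _ a
  have hquad : ∑ b ∈ F, ∑ c ∈ F, q b * q c * greenIn d (Λ : Set (Zd d)) b c =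
      ∑ c ∈ F, q c * greenIn d (Λ : Set (Zd d)) a c := by
    rw [Finset.sum_comm]
    refine Finset.sum_congr rfl fun c hc => ?_
    rw [← sum_hitMeasIn_mul_greenIn hd hFΛ' hc a, Finset.mul_sum]
    exact Finset.sum_congr rfl fun b _ => by ring
  have hvar := hψ.variance_sum F q (hquad ▸ Finset.sum_nonneg fun c _ =>
    mul_nonneg (hq0 c) (greenIn_nonneg d _ a c))
  rw [hquad] at hvar
  refine ⟨hvar, ?_, ?_⟩
  · rw [hvar]
    set s := F.sup' hF fun b => greenIn d (Λ : Set (Zd d)) a b with hs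
    have hle : ∀ b ∈ F, greenIn d (Λ : Set (Zd d)) a b ≤ s := fun b hb =>
      Finset.le_sup' (fun b => greenIn d (Λ : Set (Zd d)) a b) hb
    have hs0 : 0 ≤ s := by
      obtain ⟨b, hb⟩ := hF
      exact (greenIn_nonneg d _ a b).trans (hle b hb)
    calc ∑ b ∈ F, q b * greenIn d (Λ : Set (Zd d)) a b ≤ ∑ b ∈ F, q b * s :=
          Finset.sum_le_sum fun b hb => mul_le_mul_of_nonneg_left (hle b hb) (hq0 b)
      _ = (∑ b ∈ F, q b) * s := (Finset.sum_mul ..).symm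
      _ ≤ 1 * s := mul_le_mul_of_nonneg_right
          (sum_hitMeasIn_le_one (by omega) _ _ F a) hs0
      _ = s := one_mul s
  · exact Finset.sup'_mono_fun fun b _ => greenIn_le_green hd _ a b
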